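/- arXiv:2509.02119 — 6 statements merged into one kernel-verified Lean document; each statement's English description precedes it below -/
import Mathlib

section
/- Under the threshold-crossing setup, every feasible vector C = (C_1,…,C_K) satisfies Σ_{k≠k*} C_k·|μ_{k*} − μ_k| ≥ (μ_{k*} − μ_{k*−1}) / I(μ_{k*−1}, τ). -/
/-- Kullback–Leibler divergence between Bernoulli(p) and Bernoulli(q). -/
noncomputable def klBernoulli (p q : ℝ) : ℝ :=
  p * Real.log (p / q) + (1 - p) * Real.log ((1 - p) / (1 - q))

/-- Feasibility in the threshold-crossing setup: `C` is a vector of nonnegative reals such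
that for every `i ∈ {1,…,k*−1}` and every strictly increasing tuple `(b_i,…,b_{k*−1})`
with `b_i ≥ τ`, `b_{k*−1} < μ_{k*}` and `b_i > μ_{i−1}` when `i ≥ 2`, one has
`Σ_{j=i}^{k*−1} C_j · I(μ_j, b_j) ≥ 1`. -/
def FeasibleTC (K kstar : ℕ) (μ : ℕ → ℝ) (τ : ℝ) (C : ℕ → ℝ) : Prop :=
  (∀ k ∈ Finset.Icc 1 K, 0 ≤ C k) ∧
  ∀ i, 1 ≤ i → i ≤ kstar - 1 →
    ∀ b : ℕ → ℝ, (∀ j, i ≤ j → j + 1 ≤ kstar - 1 → b j < b (j + 1)) →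
      τ ≤ b i → b (kstar - 1) < μ kstar → (2 ≤ i → μ (i - 1) < b i) →
      1 ≤ ∑ j ∈ Finset.Icc i (kstar - 1), C j * klBernoulli (μ j) (b j)

theorem thresholdCrossing_lower_bound (K kstar : ℕ) (μ : ℕ → ℝ) (τ : ℝ) (C : ℕ → ℝ)
    (hK : 2 ≤ K)
    (hmono : ∀ j k, 1 ≤ j → j < k → k ≤ K → μ j < μ k)
    (hrange : ∀ k ∈ Finset.Icc 1 K, μ k ∈ Set.Ioo (0 : ℝ) 1)
    (hτ : τ ∈ Set.Ioo (0 : ℝ) 1)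
    (hk : kstar ∈ Finset.Icc 2 K)
    (hbelow : μ (kstar - 1) < τ) (habove : τ < μ kstar)
    (hC : FeasibleTC K kstar μ τ C) :
    (μ kstar - μ (kstar - 1)) / klBernoulli (μ (kstar - 1)) τ ≤
      ∑ k ∈ (Finset.Icc 1 K).erase kstar, C k * |μ kstar - μ k| := by
  obtain ⟨hC0, hC1⟩ := hC
  obtain ⟨hk2, hkK⟩ := Finset.mem_Icc.mp hk
  have h1 : 1 ≤ C (kstar - 1) * klBernoulli (μ (kstar - 1)) τ := by
    have h := hC1 (kstar - 1) (by omega) le_rfl (fun _ => τ)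
      (fun j hj hj' => by omega) le_rfl habove
      (fun h2 => (hmono (kstar - 1 - 1) (kstar - 1) (by omega) (by omega) (by omega)).trans hbelow)
    simpa using h
  have hc : 0 ≤ C (kstar - 1) := hC0 _ (Finset.mem_Icc.mpr ⟨by omega, by omega⟩)
  have hI : 0 < klBernoulli (μ (kstar - 1)) τ := by
    by_contra hn
    push Not at hn
    linarith [mul_nonpos_of_nonneg_of_nonpos hc hn]
  have hd : 0 < μ kstar - μ (kstar - 1) := by linarith
  have h2 : C (kstar - 1) * |μ kstar - μ (kstar - 1)| ≤
      ∑ k ∈ (Finset.Icc 1 K).erase kstar, C k * |μ kstar - μ k| := by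
    refine Finset.single_le_sum (f := fun k => C k * |μ kstar - μ k|) ?_ ?_
    · intro k hk'
      exact mul_nonneg (hC0 k (Finset.mem_of_mem_erase hk')) (abs_nonneg _)
    · exact Finset.mem_erase.mpr ⟨by omega, Finset.mem_Icc.mpr ⟨by omega, by omega⟩⟩
  refine le_trans ?_ h2
  rw [abs_of_pos hd, div_le_iff₀ hI]
  nlinarith [mul_le_mul_of_nonneg_left h1 hd.le]
end

section
/- Under the threshold-crossing setup, the vector C defined by C_{k*−1} = 1 / I(μ_{k*−1}, τ) and C_j = 0 for all j ≠ k*−1 is feasible, and its objective value satisfies Σ_{k≠k*} C_k·|μ_{k*} − μ_k| = (μ_{k*} − μ_{k*−1}) / I(μ_{k*−1}, τ). -/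
theorem klB_mono_aux {p q r : ℝ} (hp : 0 < p) (hpq : p ≤ q) (hqr : q ≤ r) (hr : r < 1) :
    klBernoulli p q ≤ klBernoulli p r := by
  unfold klBernoulli
  have hq : 0 < q := by linarith
  have hr0 : 0 < r := by linarith
  have h1p : 0 < 1 - p := by linarith
  have h1q : 0 < 1 - q := by linarith
  have h1r : 0 < 1 - r := by linarith
  have e1 := Real.log_le_sub_one_of_pos (div_pos hr0 hq)
  have e2 := Real.log_le_sub_one_of_pos (div_pos h1r h1q)
  rw [Real.log_div hr0.ne' hq.ne'] at e1
  rw [Real.log_div h1r.ne' h1q.ne'] at e2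
  rw [Real.log_div hp.ne' hq.ne', Real.log_div hp.ne' hr0.ne', Real.log_div h1p.ne' h1q.ne',
    Real.log_div h1p.ne' h1r.ne']
  have f1 := mul_le_mul_of_nonneg_left e1 hp.le
  have f2 := mul_le_mul_of_nonneg_left e2 h1p.le
  have key : p * (r / q - 1) + (1 - p) * ((1 - r) / (1 - q) - 1) ≤ 0 := by
    have : p * (r / q - 1) + (1 - p) * ((1 - r) / (1 - q) - 1)
        = -((r - q) * (q - p) / (q * (1 - q))) := by
      field_simp
      ring
    rw [this, neg_nonpos]
    exact div_nonneg (mul_nonneg (by linarith) (by linarith)) (by positivity)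
  linarith

theorem klB_pos_aux {p q : ℝ} (hp : 0 < p) (hpq : p < q) (hq1 : q < 1) :
    0 < klBernoulli p q := by
  unfold klBernoulli
  have hq : 0 < q := by linarith
  have h1p : 0 < 1 - p := by linarith
  have h1q : 0 < 1 - q := by linarith
  have e1 := Real.log_lt_sub_one_of_pos (div_pos hq hp) ((one_lt_div hp).2 hpq).ne'
  have e2 := Real.log_le_sub_one_of_pos (div_pos h1q h1p)
  rw [Real.log_div hq.ne' hp.ne'] at e1
  rw [Real.log_div h1q.ne' h1p.ne'] at e2
  rw [Real.log_div hp.ne' hq.ne', Real.log_div h1p.ne' h1q.ne']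
  have f1 := mul_lt_mul_of_pos_left e1 hp
  have f2 := mul_le_mul_of_nonneg_left e2 h1p.le
  have g1 : p * (q / p - 1) = q - p := by field_simp
  have g2 : (1 - p) * ((1 - q) / (1 - p) - 1) = p - q := by
    field_simp
    ring
  linarith

theorem thresholdCrossing_optimal_feasible (K kstar : ℕ) (μ : ℕ → ℝ) (τ : ℝ)
    (hK : 2 ≤ K)
    (hmono : ∀ j k, 1 ≤ j → j < k → k ≤ K → μ j < μ k)
    (hrange : ∀ k ∈ Finset.Icc 1 K, μ k ∈ Set.Ioo (0 : ℝ) 1)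
    (hτ : τ ∈ Set.Ioo (0 : ℝ) 1)
    (hk : kstar ∈ Finset.Icc 2 K)
    (hbelow : μ (kstar - 1) < τ) (habove : τ < μ kstar) :
    FeasibleTC K kstar μ τ
      (fun j => if j = kstar - 1 then 1 / klBernoulli (μ (kstar - 1)) τ else 0) ∧
    ∑ k ∈ (Finset.Icc 1 K).erase kstar,
        (if k = kstar - 1 then 1 / klBernoulli (μ (kstar - 1)) τ else 0) * |μ kstar - μ k|
      = (μ kstar - μ (kstar - 1)) / klBernoulli (μ (kstar - 1)) τ := by
  obtain ⟨hk2, hkK⟩ := Finset.mem_Icc.1 hk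
  have hm := hrange (kstar - 1) (Finset.mem_Icc.2 ⟨by omega, by omega⟩)
  have hM := hrange kstar (Finset.mem_Icc.2 ⟨by omega, by omega⟩)
  have hpos := klB_pos_aux hm.1 hbelow hτ.2
  refine ⟨⟨?_, ?_⟩, ?_⟩
  · intro k _
    dsimp only
    split_ifs
    · positivity
    · exact le_rfl
  · intro i hi1 hik b hb hbi hbk _
    have hle : ∀ j, i ≤ j → j ≤ kstar - 1 → τ ≤ b j := by
      intro j hij
      induction j, hij using Nat.le_induction with
      | base => exact fun _ => hbi
      | succ n hn ih =>
        intro h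
        exact (ih (by omega)).trans (hb n hn h).le
    beta_reduce
    have hmon := klB_mono_aux hm.1 hbelow.le (hle _ hik le_rfl) (hbk.trans hM.2)
    rw [Finset.sum_eq_single_of_mem (kstar - 1) (Finset.mem_Icc.2 ⟨hik, le_rfl⟩)]
    · rw [if_pos rfl, one_div, inv_mul_eq_div, le_div_iff₀ hpos, one_mul]
      exact hmon
    · intro j _ hj
      rw [if_neg hj, zero_mul]
  · rw [Finset.sum_eq_single_of_mem (kstar - 1)
      (Finset.mem_erase.2 ⟨by omega, Finset.mem_Icc.2 ⟨by omega, by omega⟩⟩)]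
    · rw [if_pos rfl, abs_of_pos (by linarith), one_div, inv_mul_eq_div]
    · intro j _ hj
      rw [if_neg hj, zero_mul]
end

section
/- Under the threshold-crossing setup, the infimum of Σ_{k≠k*} C_k·|μ_{k*} − μ_k| over all feasible vectors C equals (μ_{k*} − μ_{k*−1}) / I(μ_{k*−1}, τ), and this infimum is attained. -/
/-- Strict monotonicity of the Bernoulli divergence to the right of its first argument. -/
theorem klBernoulli_strict {p q r : ℝ} (hp0 : 0 < p) (hpq : p ≤ q) (hqr : q < r) (hr : r < 1) :
    klBernoulli p q < klBernoulli p r := by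
  have hq : 0 < q := by linarith
  have hr0 : 0 < r := by linarith
  have h1p : 0 < 1 - p := by linarith
  have h1q : 0 < 1 - q := by linarith
  have h1r : 0 < 1 - r := by linarith
  unfold klBernoulli
  rw [Real.log_div hp0.ne' hq.ne', Real.log_div hp0.ne' hr0.ne',
    Real.log_div h1p.ne' h1q.ne', Real.log_div h1p.ne' h1r.ne']
  have e1 : Real.log (r / q) < r / q - 1 := by
    apply Real.log_lt_sub_one_of_pos (by positivity)
    intro h
    rw [div_eq_one_iff_eq hq.ne'] at h
    linarith
  have e2 : Real.log ((1 - r) / (1 - q)) ≤ (1 - r) / (1 - q) - 1 :=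
    Real.log_le_sub_one_of_pos (by positivity)
  rw [Real.log_div hr0.ne' hq.ne'] at e1
  rw [Real.log_div h1r.ne' h1q.ne'] at e2
  have f1 := mul_lt_mul_of_pos_left e1 hp0
  have f2 := mul_le_mul_of_nonneg_left e2 h1p.le
  have key : p * (r / q - 1) + (1 - p) * ((1 - r) / (1 - q) - 1) ≤ 0 := by
    have : p * (r / q - 1) + (1 - p) * ((1 - r) / (1 - q) - 1)
        = - ((r - q) * (q - p) / (q * (1 - q))) := by
      field_simp
      ring
    rw [this, neg_nonpos]
    exact div_nonneg (mul_nonneg (by linarith) (by linarith)) (by positivity)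
  nlinarith

theorem klBernoulli_self_zero {p : ℝ} (hp0 : 0 < p) (hp1 : p < 1) : klBernoulli p p = 0 := by
  have : 1 - p ≠ 0 := by linarith
  simp [klBernoulli, div_self hp0.ne', div_self this]

theorem thresholdCrossing_inf (K kstar : ℕ) (μ : ℕ → ℝ) (τ : ℝ)
    (hK : 2 ≤ K)
    (hmono : ∀ j k, 1 ≤ j → j < k → k ≤ K → μ j < μ k)
    (hrange : ∀ k ∈ Finset.Icc 1 K, μ k ∈ Set.Ioo (0 : ℝ) 1)
    (hτ : τ ∈ Set.Ioo (0 : ℝ) 1)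
    (hk : kstar ∈ Finset.Icc 2 K)
    (hbelow : μ (kstar - 1) < τ) (habove : τ < μ kstar) :
    IsLeast
      {v : ℝ | ∃ C : ℕ → ℝ, FeasibleTC K kstar μ τ C ∧
        v = ∑ k ∈ (Finset.Icc 1 K).erase kstar, C k * |μ kstar - μ k|}
      ((μ kstar - μ (kstar - 1)) / klBernoulli (μ (kstar - 1)) τ) := by
  obtain ⟨hk2, hkK⟩ := Finset.mem_Icc.mp hk
  obtain ⟨m, rfl⟩ : ∃ m, kstar = m + 1 := ⟨kstar - 1, by omega⟩
  simp only [Nat.add_sub_cancel] at hbelow ⊢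
  have hm1 : 1 ≤ m := by omega
  have hmm : m ∈ Finset.Icc 1 K := Finset.mem_Icc.mpr ⟨hm1, by omega⟩
  have hme : m ∈ (Finset.Icc 1 K).erase (m + 1) := Finset.mem_erase.mpr ⟨by omega, hmm⟩
  obtain ⟨hp0, hp1⟩ := hrange m hmm
  have hs1 : μ (m + 1) < 1 := (hrange (m + 1) (Finset.mem_Icc.mpr ⟨by omega, hkK⟩)).2
  have hI : 0 < klBernoulli (μ m) τ := by
    have := klBernoulli_strict hp0 le_rfl hbelow hτ.2
    rwa [klBernoulli_self_zero hp0 hp1] at this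
  have hgap : 0 < μ (m + 1) - μ m := by linarith
  constructor
  · refine ⟨fun k => if k = m then 1 / klBernoulli (μ m) τ else 0, ⟨?_, ?_⟩, ?_⟩
    · intro k _
      dsimp only
      split_ifs <;> positivity
    · intro i hi him b hb hbi hbm _
      simp only [Nat.add_sub_cancel] at him hb hbm ⊢
      have hmon : ∀ j, i ≤ j → j ≤ m → b i ≤ b j := by
        intro j hij
        induction j, hij using Nat.le_induction with
        | base => intro _; exact le_rfl
        | succ n hn ih => intro h; exact (ih (by omega)).trans (hb n hn h).le
      have hbτ : τ ≤ b m := hbi.trans (hmon m him le_rfl)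
      have hle : klBernoulli (μ m) τ ≤ klBernoulli (μ m) (b m) := by
        rcases hbτ.eq_or_lt with h | h
        · rw [← h]
        · exact (klBernoulli_strict hp0 hbelow.le h (by linarith)).le
      rw [Finset.sum_eq_single_of_mem m (Finset.mem_Icc.mpr ⟨him, le_rfl⟩)
        (fun j _ hj => by simp [hj])]
      rw [if_pos rfl, one_div_mul_eq_div, le_div_iff₀ hI]
      linarith
    · rw [Finset.sum_eq_single_of_mem m hme (fun j _ hj => by simp [hj])]
      dsimp only
      rw [if_pos rfl, abs_of_pos hgap, one_div_mul_eq_div]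
  · rintro v ⟨C, ⟨hC0, hC⟩, rfl⟩
    have h := hC m hm1 (by simp) (fun _ => τ)
      (fun j h1 h2 => by simp only [Nat.add_sub_cancel] at h2; omega) le_rfl habove
      (fun h2 => (hmono (m - 1) m (by omega) (by omega) (by omega)).trans hbelow)
    simp only [Nat.add_sub_cancel, Finset.Icc_self, Finset.sum_singleton] at h
    calc (μ (m + 1) - μ m) / klBernoulli (μ m) τ ≤ C m * |μ (m + 1) - μ m| := by
          rw [abs_of_pos hgap, div_le_iff₀ hI]
          nlinarith
      _ ≤ _ := Finset.single_le_sum (f := fun k => C k * |μ (m + 1) - μ k|)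
          (fun k hk' => mul_nonneg (hC0 k (Finset.mem_of_mem_erase hk')) (abs_nonneg _)) hme
end

section
/- Under the l-th-above-threshold setup, every feasible vector C = (C_1,…,C_K) satisfies C_{k'−1} ≥ 1 / I(μ_{k'−1}, τ), and moreover, if l ≥ 2 and k* < K, also C_{k'} ≥ 1 / I(μ_{k'}, τ). Consequently Σ_{k≠k*} C_k·|μ_{k*} − μ_k| ≥ (μ_{k*} − μ_{k'}) / I(μ_{k'}, τ) · 1{k* ≠ K} + (μ_{k*} − μ_{k'−1}) / I(μ_{k'−1}, τ). -/
/-- Feasibility in the l-th-above-threshold setup: `C` is nonnegative and satisfies the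
two families of constraints (A) and (B). -/
def FeasibleLth (K kp l kstar : ℕ) (μ : ℕ → ℝ) (τ : ℝ) (C : ℕ → ℝ) : Prop :=
  (∀ k ∈ Finset.Icc 1 K, 0 ≤ C k) ∧
  -- (A): for every m with k' ≤ m ≤ k' + min (l − 2) (K − k* − 1) (as integers; the family
  -- is empty when l = 1 or k* = K) and every strictly increasing tuple (b_{k'},…,b_m)
  -- with b_{k'} > μ_{k'−1} and b_m < τ
  (∀ m : ℕ, kp ≤ m → (m : ℤ) ≤ (kp : ℤ) + min ((l : ℤ) - 2) ((K : ℤ) - (kstar : ℤ) - 1) →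
    ∀ b : ℕ → ℝ, (∀ j, kp ≤ j → j + 1 ≤ m → b j < b (j + 1)) →
      μ (kp - 1) < b kp → b m < τ →
      1 ≤ ∑ j ∈ Finset.Icc kp m, C j * klBernoulli (μ j) (b j)) ∧
  -- (B): for every d ∈ {1,…,k'−2} and every strictly increasing tuple
  -- (b_{k'−d},…,b_{k'−1}) with b_{k'−d} ≥ τ and b_{k'−1} < μ_{k'}
  (∀ d : ℕ, 1 ≤ d → d ≤ kp - 2 →
    ∀ b : ℕ → ℝ, (∀ j, kp - d ≤ j → j + 1 ≤ kp - 1 → b j < b (j + 1)) →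
      τ ≤ b (kp - d) → b (kp - 1) < μ kp →
      1 ≤ ∑ j ∈ Finset.Icc (kp - d) (kp - 1), C j * klBernoulli (μ j) (b j))

theorem one_div_le_of_one_le_mul_aux {c x : ℝ} (hc : 0 ≤ c) (h : 1 ≤ c * x) :
    1 / x ≤ c := by
  have hx : 0 < x := by
    by_contra hx
    push Not at hx
    have := mul_nonpos_of_nonneg_of_nonpos hc hx
    linarith
  rwa [div_le_iff₀ hx]

theorem klBernoulli_continuousAt_aux {p q : ℝ} (hp : p ∈ Set.Ioo (0 : ℝ) 1)
    (hq : q ∈ Set.Ioo (0 : ℝ) 1) : ContinuousAt (fun b => klBernoulli p b) q := by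
  obtain ⟨hp0, hp1⟩ := hp
  obtain ⟨hq0, hq1⟩ := hq
  have h1 : (1 - p) ≠ 0 := by linarith
  have h2 : (1 - q) ≠ 0 := by linarith
  unfold klBernoulli
  refine ContinuousAt.add ?_ ?_
  · refine continuousAt_const.mul (ContinuousAt.log ?_ (div_ne_zero hp0.ne' hq0.ne'))
    exact continuousAt_const.div continuousAt_id hq0.ne'
  · refine continuousAt_const.mul (ContinuousAt.log ?_ (div_ne_zero h1 h2))
    exact continuousAt_const.div (continuousAt_const.sub continuousAt_id) h2

theorem lthAboveThreshold_lower_bound (K kp l kstar : ℕ) (μ : ℕ → ℝ) (τ : ℝ) (C : ℕ → ℝ)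
    (hK : 2 ≤ K)
    (hmono : ∀ j k, 1 ≤ j → j < k → k ≤ K → μ j < μ k)
    (hrange : ∀ k ∈ Finset.Icc 1 K, μ k ∈ Set.Ioo (0 : ℝ) 1)
    (hτ : τ ∈ Set.Ioo (0 : ℝ) 1)
    (hkp : kp ∈ Finset.Icc 3 K)
    (hbelow : μ (kp - 1) < τ) (habove : τ < μ kp)
    (hl : 1 ≤ l) (hkstar : kstar = kp + l - 1) (hkstarK : kstar ≤ K)
    (hC : FeasibleLth K kp l kstar μ τ C) :
    1 / klBernoulli (μ (kp - 1)) τ ≤ C (kp - 1) ∧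
    (2 ≤ l → kstar < K → 1 / klBernoulli (μ kp) τ ≤ C kp) ∧
    (μ kstar - μ kp) / klBernoulli (μ kp) τ * (if kstar ≠ K then (1 : ℝ) else 0)
        + (μ kstar - μ (kp - 1)) / klBernoulli (μ (kp - 1)) τ ≤
      ∑ k ∈ (Finset.Icc 1 K).erase kstar, C k * |μ kstar - μ k| := by
  obtain ⟨hC0, hA, hB⟩ := hC
  rw [Finset.mem_Icc] at hkp
  obtain ⟨hkp3, hkpK⟩ := hkp
  have hc1 : 0 ≤ C (kp - 1) := hC0 _ (Finset.mem_Icc.2 (by omega))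
  have hc2 : 0 ≤ C kp := hC0 _ (Finset.mem_Icc.2 (by omega))
  have P1 : 1 / klBernoulli (μ (kp - 1)) τ ≤ C (kp - 1) := by
    apply one_div_le_of_one_le_mul_aux hc1
    have := hB 1 le_rfl (by omega) (fun _ => τ) (fun j h1 h2 => by omega) le_rfl habove
    simpa using this
  have P2 : 2 ≤ l → kstar < K → 1 / klBernoulli (μ kp) τ ≤ C kp := by
    intro hl2 hkK
    apply one_div_le_of_one_le_mul_aux hc2
    have hev : ∀ᶠ b in nhdsWithin τ (Set.Iio τ), 1 ≤ C kp * klBernoulli (μ kp) b := by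
      filter_upwards [Ioo_mem_nhdsLT hbelow] with b hb
      have := hA kp le_rfl (by omega) (fun _ => b) (fun j h1 h2 => by omega) hb.1 hb.2
      simpa using this
    have hct : ContinuousAt (fun b => C kp * klBernoulli (μ kp) b) τ :=
      continuousAt_const.mul
        (klBernoulli_continuousAt_aux (hrange kp (Finset.mem_Icc.2 (by omega))) hτ)
    exact ge_of_tendsto (hct.tendsto.mono_left nhdsWithin_le_nhds) hev
  refine ⟨P1, P2, ?_⟩
  have hnn : ∀ k ∈ (Finset.Icc 1 K).erase kstar, 0 ≤ C k * |μ kstar - μ k| := fun k hk =>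
    mul_nonneg (hC0 k (Finset.mem_of_mem_erase hk)) (abs_nonneg _)
  have hlt1 : μ (kp - 1) < μ kstar := hmono _ _ (by omega) (by omega) hkstarK
  have T1 : (μ kstar - μ (kp - 1)) / klBernoulli (μ (kp - 1)) τ
      ≤ C (kp - 1) * |μ kstar - μ (kp - 1)| := by
    rw [abs_of_pos (sub_pos.2 hlt1), div_eq_mul_one_div, mul_comm]
    exact mul_le_mul_of_nonneg_right P1 (sub_pos.2 hlt1).le
  have m1 : kp - 1 ∈ (Finset.Icc 1 K).erase kstar := by
    simp only [Finset.mem_erase, Finset.mem_Icc]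
    omega
  by_cases hcase : 2 ≤ l ∧ kstar < K
  · obtain ⟨hl2, hkK⟩ := hcase
    have hlt2 : μ kp < μ kstar := hmono _ _ (by omega) (by omega) hkstarK
    have T2 : (μ kstar - μ kp) / klBernoulli (μ kp) τ ≤ C kp * |μ kstar - μ kp| := by
      rw [abs_of_pos (sub_pos.2 hlt2), div_eq_mul_one_div, mul_comm]
      exact mul_le_mul_of_nonneg_right (P2 hl2 hkK) (sub_pos.2 hlt2).le
    have m2 : kp ∈ (Finset.Icc 1 K).erase kstar := by
      simp only [Finset.mem_erase, Finset.mem_Icc]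
      omega
    have hsub : ({kp, kp - 1} : Finset ℕ) ⊆ (Finset.Icc 1 K).erase kstar := by
      intro x hx
      simp only [Finset.mem_insert, Finset.mem_singleton] at hx
      rcases hx with rfl | rfl
      · exact m2
      · exact m1
    have hs := Finset.sum_le_sum_of_subset_of_nonneg hsub (fun k hk _ => hnn k hk)
    rw [Finset.sum_pair (by omega)] at hs
    rw [if_pos hkK.ne, mul_one]
    linarith
  · have hz : (μ kstar - μ kp) / klBernoulli (μ kp) τ * (if kstar ≠ K then (1 : ℝ) else 0)
        = 0 := by
      by_cases hkK : kstar = K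
      · simp [hkK]
      · have : kstar = kp := by omega
        simp [this]
    rw [hz, zero_add]
    exact T1.trans (Finset.single_le_sum hnn m1)
end

section
/- Under the l-th-above-threshold setup, the vector C defined by C_{k'} = 1 / I(μ_{k'}, τ) if l ≥ 2 and k* < K (and C_{k'} = 0 otherwise), C_{k'−1} = 1 / I(μ_{k'−1}, τ), and C_j = 0 for all other j, is feasible, and its objective value satisfies Σ_{k≠k*} C_k·|μ_{k*} − μ_k| = (μ_{k*} − μ_{k'}) / I(μ_{k'}, τ) · 1{k* ≠ K} + (μ_{k*} − μ_{k'−1}) / I(μ_{k'−1}, τ). -/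
theorem klB_mono {p a b : ℝ} (hp : p ∈ Set.Ioo (0:ℝ) 1) (ha : a ∈ Set.Ioo (0:ℝ) 1)
    (hb : b ∈ Set.Ioo (0:ℝ) 1) (h : 0 ≤ (b - a) * (a - p)) :
    klBernoulli p a ≤ klBernoulli p b := by
  obtain ⟨hp0, hp1⟩ := hp
  obtain ⟨ha0, ha1⟩ := ha
  obtain ⟨hb0, hb1⟩ := hb
  have hp1' : 0 < 1 - p := by linarith
  have ha1' : 0 < 1 - a := by linarith
  have hb1' : 0 < 1 - b := by linarith
  unfold klBernoulli
  rw [Real.log_div hp0.ne' ha0.ne', Real.log_div hp1'.ne' ha1'.ne',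
    Real.log_div hp0.ne' hb0.ne', Real.log_div hp1'.ne' hb1'.ne']
  have h1 := Real.log_le_sub_one_of_pos (div_pos hb0 ha0)
  have h2 := Real.log_le_sub_one_of_pos (div_pos hb1' ha1')
  rw [Real.log_div hb0.ne' ha0.ne'] at h1
  rw [Real.log_div hb1'.ne' ha1'.ne'] at h2
  have h3 := mul_le_mul_of_nonneg_left h1 hp0.le
  have h4 := mul_le_mul_of_nonneg_left h2 hp1'.le
  have h5 : p * (b / a - 1) + (1 - p) * ((1 - b) / (1 - a) - 1)
      = - ((b - a) * (a - p) / (a * (1 - a))) := by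
    field_simp
    ring
  have h6 : 0 ≤ (b - a) * (a - p) / (a * (1 - a)) := by positivity
  linarith

theorem klB_pos {p q : ℝ} (hp : p ∈ Set.Ioo (0:ℝ) 1) (hq : q ∈ Set.Ioo (0:ℝ) 1)
    (h : p ≠ q) : 0 < klBernoulli p q := by
  obtain ⟨hp0, hp1⟩ := hp
  obtain ⟨hb0, hb1⟩ := hq
  have hp1' : 0 < 1 - p := by linarith
  have hb1' : 0 < 1 - q := by linarith
  unfold klBernoulli
  rw [Real.log_div hp0.ne' hb0.ne', Real.log_div hp1'.ne' hb1'.ne']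
  have hne : q / p ≠ 1 := by
    intro h'
    rw [div_eq_one_iff_eq hp0.ne'] at h'
    exact h h'.symm
  have h1 := Real.log_lt_sub_one_of_pos (div_pos hb0 hp0) hne
  have h2 := Real.log_le_sub_one_of_pos (div_pos hb1' hp1')
  rw [Real.log_div hb0.ne' hp0.ne'] at h1
  rw [Real.log_div hb1'.ne' hp1'.ne'] at h2
  have h3 := mul_lt_mul_of_pos_left h1 hp0
  have h4 := mul_le_mul_of_nonneg_left h2 hp1'.le
  have h5 : p * (q / p - 1) + (1 - p) * ((1 - q) / (1 - p) - 1) = 0 := by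
    field_simp
    ring
  linarith

theorem chain_le {b : ℕ → ℝ} {s t : ℕ} (hst : s ≤ t)
    (h : ∀ j, s ≤ j → j + 1 ≤ t → b j < b (j + 1)) : b s ≤ b t := by
  induction t, hst using Nat.le_induction with
  | base => exact le_rfl
  | succ n hn ih =>
    exact (ih fun j h1 h2 => h j h1 (by omega)).trans (h n hn le_rfl).le

theorem lthAboveThreshold_optimal_feasible (K kp l kstar : ℕ) (μ : ℕ → ℝ) (τ : ℝ)
    (hK : 2 ≤ K)
    (hmono : ∀ j k, 1 ≤ j → j < k → k ≤ K → μ j < μ k)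
    (hrange : ∀ k ∈ Finset.Icc 1 K, μ k ∈ Set.Ioo (0 : ℝ) 1)
    (hτ : τ ∈ Set.Ioo (0 : ℝ) 1)
    (hkp : kp ∈ Finset.Icc 3 K)
    (hbelow : μ (kp - 1) < τ) (habove : τ < μ kp)
    (hl : 1 ≤ l) (hkstar : kstar = kp + l - 1) (hkstarK : kstar ≤ K) :
    FeasibleLth K kp l kstar μ τ
      (fun j => if j = kp - 1 then 1 / klBernoulli (μ (kp - 1)) τ
        else if j = kp ∧ 2 ≤ l ∧ kstar < K then 1 / klBernoulli (μ kp) τ else 0) ∧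
    ∑ k ∈ (Finset.Icc 1 K).erase kstar,
        (if k = kp - 1 then 1 / klBernoulli (μ (kp - 1)) τ
          else if k = kp ∧ 2 ≤ l ∧ kstar < K then 1 / klBernoulli (μ kp) τ else 0)
          * |μ kstar - μ k|
      = (μ kstar - μ kp) / klBernoulli (μ kp) τ * (if kstar ≠ K then (1 : ℝ) else 0)
          + (μ kstar - μ (kp - 1)) / klBernoulli (μ (kp - 1)) τ := by
  obtain ⟨hk3, hkK⟩ := Finset.mem_Icc.mp hkp
  have r1 := hrange (kp - 1) (Finset.mem_Icc.mpr ⟨by omega, by omega⟩)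
  have r2 := hrange kp (Finset.mem_Icc.mpr ⟨by omega, by omega⟩)
  have P1 := klB_pos r1 hτ hbelow.ne
  have P2 := klB_pos r2 hτ habove.ne'
  refine ⟨⟨?_, ?_, ?_⟩, ?_⟩
  · intro k _
    dsimp only
    split_ifs <;> positivity
  · intro m hm hm2 b hb hb1 hb2
    have hl2 : 2 ≤ l ∧ kstar < K := by omega
    have hle := chain_le hm hb
    have hM : klBernoulli (μ kp) τ ≤ klBernoulli (μ kp) (b kp) := by
      apply klB_mono r2 hτ ⟨r1.1.trans hb1, by linarith [hτ.2]⟩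
      nlinarith
    dsimp only
    rw [Finset.sum_eq_single kp]
    · rw [if_neg (by omega), if_pos ⟨rfl, hl2⟩, one_div, inv_mul_eq_div, le_div_iff₀ P2]
      linarith
    · intro j hj hne
      have := Finset.mem_Icc.mp hj
      rw [if_neg (by omega), if_neg (by omega), zero_mul]
    · intro hn
      exact absurd (Finset.mem_Icc.mpr ⟨le_rfl, hm⟩) hn
  · intro d hd1 hd2 b hb hb1 hb2
    have hle := chain_le (by omega : kp - d ≤ kp - 1) hb
    have hM : klBernoulli (μ (kp - 1)) τ ≤ klBernoulli (μ (kp - 1)) (b (kp - 1)) := by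
      apply klB_mono r1 hτ ⟨by linarith [hτ.1], hb2.trans r2.2⟩
      nlinarith
    dsimp only
    rw [Finset.sum_eq_single (kp - 1)]
    · rw [if_pos rfl, one_div, inv_mul_eq_div, le_div_iff₀ P1]
      linarith
    · intro j hj hne
      have := Finset.mem_Icc.mp hj
      rw [if_neg (by omega), if_neg (by omega), zero_mul]
    · intro hn
      exact absurd (Finset.mem_Icc.mpr ⟨by omega, le_rfl⟩) hn
  · have m1 : kp - 1 ∈ (Finset.Icc 1 K).erase kstar :=
      Finset.mem_erase.mpr ⟨by omega, Finset.mem_Icc.mpr ⟨by omega, by omega⟩⟩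
    have a1 : μ (kp - 1) < μ kstar := hmono _ _ (by omega) (by omega) hkstarK
    rw [← Finset.add_sum_erase _ _ m1, if_pos rfl, abs_of_pos (sub_pos.mpr a1), add_comm,
      one_div, inv_mul_eq_div]
    congr 1
    by_cases hc : 2 ≤ l ∧ kstar < K
    · have a2 : μ kp < μ kstar := hmono _ _ (by omega) (by omega) hkstarK
      rw [Finset.sum_eq_single kp]
      · rw [if_neg (by omega), if_pos ⟨rfl, hc⟩, if_pos (by omega), one_div, inv_mul_eq_div,
          abs_of_pos (sub_pos.mpr a2), mul_one]
      · intro j hj hne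
        rw [if_neg (Finset.ne_of_mem_erase hj), if_neg (fun h => hne h.1), zero_mul]
      · intro hn
        exact absurd (Finset.mem_erase.mpr ⟨by omega, Finset.mem_erase.mpr
          ⟨by omega, Finset.mem_Icc.mpr ⟨by omega, by omega⟩⟩⟩) hn
    · rw [Finset.sum_eq_zero]
      · by_cases hK' : kstar = K
        · simp [hK']
        · have : kstar = kp := by omega
          simp [this]
      · intro j hj
        rw [if_neg (Finset.ne_of_mem_erase hj), if_neg (fun h => hc h.2), zero_mul]
end

section
/- Under the lower proximity setup, the infimum of Σ_{k≠k*} C_k·|μ_{k*} − μ_k| over all feasible vectors C equals (μ_{k*+1} − μ_{k*}) / I(μ_{k*+1}, 2τ − μ_{k*}), and it is attained by the vector C with C_{k*+1} = 1 / I(μ_{k*+1}, 2τ − μ_{k*}) and C_j = 0 for all j ≠ k*+1; moreover 2τ − μ_{k*} < μ_{k*+1}, so this quantity is well defined. -/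
/-- Feasibility in the lower proximity setup: `C` is nonnegative and for every
`i ∈ {k*+1,…,K}` and every strictly increasing tuple `(b_{k*+1},…,b_i)` with
`b_i < 2τ − μ_{k*}`, `b_{k*+1} > μ_{k*}` and `b_i < μ_{i+1}` when `i ≤ K−1`, one has
`Σ_{j=k*+1}^{i} C_j · I(μ_j, b_j) ≥ 1`. -/
def FeasibleProxLower (K kstar : ℕ) (μ : ℕ → ℝ) (τ : ℝ) (C : ℕ → ℝ) : Prop :=
  (∀ k ∈ Finset.Icc 1 K, 0 ≤ C k) ∧
  ∀ i, kstar + 1 ≤ i → i ≤ K →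
    ∀ b : ℕ → ℝ, (∀ j, kstar + 1 ≤ j → j + 1 ≤ i → b j < b (j + 1)) →
      b i < 2 * τ - μ kstar → μ kstar < b (kstar + 1) → (i ≤ K - 1 → b i < μ (i + 1)) →
      1 ≤ ∑ j ∈ Finset.Icc (kstar + 1) i, C j * klBernoulli (μ j) (b j)

theorem kl_gap (p q d : ℝ) (hq : 0 < q) (hqd : q ≤ d) (hdp : d ≤ p) (hp : p < 1) :
    klBernoulli p d + (d - q) * (p - d) / (d * (1 - d)) ≤ klBernoulli p q := by
  have hd : 0 < d := by linarith
  have hp0 : 0 < p := by linarith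
  have h1d : 0 < 1 - d := by linarith
  have h1q : 0 < 1 - q := by linarith
  have h1p : 0 < 1 - p := by linarith
  unfold klBernoulli
  rw [Real.log_div hp0.ne' hd.ne', Real.log_div h1p.ne' h1d.ne',
    Real.log_div hp0.ne' hq.ne', Real.log_div h1p.ne' h1q.ne']
  have e1 := Real.log_le_sub_one_of_pos (div_pos hq hd)
  have e2 := Real.log_le_sub_one_of_pos (div_pos h1q h1d)
  rw [Real.log_div hq.ne' hd.ne'] at e1
  rw [Real.log_div h1q.ne' h1d.ne'] at e2
  have e3 := mul_le_mul_of_nonneg_left e1 hp0.le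
  have e4 := mul_le_mul_of_nonneg_left e2 h1p.le
  have e5 : (d - q) * (p - d) / (d * (1 - d))
      = - (p * (q / d - 1)) - (1 - p) * ((1 - q) / (1 - d) - 1) := by
    field_simp
    ring
  rw [e5]
  linarith

theorem kl_anti (p q d : ℝ) (hq : 0 < q) (hqd : q ≤ d) (hdp : d ≤ p) (hp : p < 1) :
    klBernoulli p d ≤ klBernoulli p q := by
  have h := kl_gap p q d hq hqd hdp hp
  have : 0 ≤ (d - q) * (p - d) / (d * (1 - d)) :=
    div_nonneg (mul_nonneg (by linarith) (by linarith))
      (mul_nonneg (by linarith) (by linarith))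
  linarith

theorem kl_pos (p d : ℝ) (hd : 0 < d) (hdp : d < p) (hp : p < 1) :
    0 < klBernoulli p d := by
  have h0 : klBernoulli p p = 0 := by
    unfold klBernoulli
    rw [div_self (by linarith), div_self (by linarith)]
    simp
  have h1 := kl_anti p ((d + p) / 2) p (by linarith) (by linarith) le_rfl hp
  have h2 := kl_gap p d ((d + p) / 2) hd (by linarith) (by linarith) hp
  have : 0 < ((d + p) / 2 - d) * (p - (d + p) / 2) / ((d + p) / 2 * (1 - (d + p) / 2)) :=
    div_pos (mul_pos (by linarith) (by linarith)) (mul_pos (by linarith) (by linarith))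
  linarith

theorem kl_cont (p d : ℝ) (hp0 : 0 < p) (hp : p < 1) (hd : 0 < d) (hd1 : d < 1) :
    ContinuousAt (fun q => klBernoulli p q) d := by
  unfold klBernoulli
  have h1 : p / d ≠ 0 := (div_pos hp0 hd).ne'
  have h1d : 0 < 1 - d := by linarith
  have h2 : (1 - p) / (1 - d) ≠ 0 := (div_pos (by linarith) h1d).ne'
  have c1 : ContinuousAt (fun q : ℝ => p / q) d := continuousAt_const.div continuousAt_id hd.ne'
  have c2 : ContinuousAt (fun q : ℝ => (1 - p) / (1 - q)) d :=
    continuousAt_const.div (continuousAt_const.sub continuousAt_id) h1d.ne'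
  exact (continuousAt_const.mul (c1.log h1)).add (continuousAt_const.mul (c2.log h2))

theorem proximityLower_inf (K kstar : ℕ) (μ : ℕ → ℝ) (τ : ℝ)
    (hK : 2 ≤ K)
    (hmono : ∀ j k, 1 ≤ j → j < k → k ≤ K → μ j < μ k)
    (hrange : ∀ k ∈ Finset.Icc 1 K, μ k ∈ Set.Ioo (0 : ℝ) 1)
    (hτ : τ ∈ Set.Ioo (0 : ℝ) 1)
    (hk : kstar ∈ Finset.Icc 1 (K - 1))
    (hlow : μ kstar < τ)
    (hclosest : ∀ k ∈ Finset.Icc 1 K, k ≠ kstar → |μ kstar - τ| < |μ k - τ|) :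
    2 * τ - μ kstar < μ (kstar + 1) ∧
    IsLeast
      {v : ℝ | ∃ C : ℕ → ℝ, FeasibleProxLower K kstar μ τ C ∧
        v = ∑ k ∈ (Finset.Icc 1 K).erase kstar, C k * |μ kstar - μ k|}
      ((μ (kstar + 1) - μ kstar) / klBernoulli (μ (kstar + 1)) (2 * τ - μ kstar)) ∧
    FeasibleProxLower K kstar μ τ
      (fun j => if j = kstar + 1
        then 1 / klBernoulli (μ (kstar + 1)) (2 * τ - μ kstar) else 0) ∧
    ∑ k ∈ (Finset.Icc 1 K).erase kstar,
        (if k = kstar + 1 then 1 / klBernoulli (μ (kstar + 1)) (2 * τ - μ kstar) else 0)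
          * |μ kstar - μ k|
      = (μ (kstar + 1) - μ kstar) / klBernoulli (μ (kstar + 1)) (2 * τ - μ kstar) := by
  have hk' := Finset.mem_Icc.mp hk
  have hk1 : 1 ≤ kstar := hk'.1
  have hk2 : kstar + 1 ≤ K := by omega
  have hlt : μ kstar < μ (kstar + 1) := hmono _ _ hk1 (by omega) hk2
  have hm0 := (hrange kstar (Finset.mem_Icc.mpr ⟨hk1, by omega⟩)).1
  have hm1 := (hrange (kstar + 1) (Finset.mem_Icc.mpr ⟨by omega, hk2⟩)).2
  have hd : 2 * τ - μ kstar < μ (kstar + 1) := by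
    have h := hclosest (kstar + 1) (Finset.mem_Icc.mpr ⟨by omega, hk2⟩) (by omega)
    rw [abs_of_neg (by linarith : μ kstar - τ < 0)] at h
    rcases lt_abs.mp h with h | h <;> linarith
  set p := μ (kstar + 1) with hpdef
  set d := 2 * τ - μ kstar with hddef
  have hmd : μ kstar < d := by rw [hddef]; linarith
  have hI : 0 < klBernoulli p d := kl_pos p d (by linarith) hd hm1
  have hmem : kstar + 1 ∈ (Finset.Icc 1 K).erase kstar := by
    simp only [Finset.mem_erase, Finset.mem_Icc]; omega
  have habs : |μ kstar - p| = p - μ kstar := by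
    rw [abs_of_neg (by linarith)]; ring
  have hfeas : FeasibleProxLower K kstar μ τ
      (fun j => if j = kstar + 1 then 1 / klBernoulli p d else 0) := by
    refine ⟨fun k _ => ?_, ?_⟩
    · dsimp only
      split_ifs
      · positivity
      · exact le_rfl
    · intro i hi hiK b hb hbd hbm _
      have hle : ∀ n, kstar + 1 ≤ n → n ≤ i → b (kstar + 1) ≤ b n := by
        intro n hn
        induction n, hn using Nat.le_induction with
        | base => intro _; exact le_rfl
        | succ n hn ih => intro h; exact (ih (by omega)).trans (hb n hn h).le
      have hbi := hle i hi le_rfl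
      rw [Finset.sum_eq_single_of_mem (kstar + 1) (Finset.mem_Icc.mpr ⟨le_rfl, hi⟩)
        (fun j _ hj => by simp [hj])]
      simp only [if_true]
      rw [← hpdef, one_div_mul_eq_div, le_div_iff₀ hI, one_mul]
      exact kl_anti p _ d (by linarith) (by linarith) hd.le hm1
  have hsum : ∑ k ∈ (Finset.Icc 1 K).erase kstar,
        (if k = kstar + 1 then 1 / klBernoulli p d else 0) * |μ kstar - μ k|
      = (p - μ kstar) / klBernoulli p d := by
    rw [Finset.sum_eq_single_of_mem (kstar + 1) hmem (fun j _ hj => by simp [hj])]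
    simp only [if_true]
    rw [← hpdef, habs, one_div_mul_eq_div]
  refine ⟨hd, ⟨⟨_, hfeas, hsum.symm⟩, ?_⟩, hfeas, hsum⟩
  rintro v ⟨C, ⟨hC0, hC⟩, rfl⟩
  have hc : ∀ q, μ kstar < q → q < d → 1 ≤ C (kstar + 1) * klBernoulli p q := by
    intro q hq hqd
    have h := hC (kstar + 1) le_rfl hk2 (fun _ => q) (fun j h1 h2 => by omega) hqd hq
      (fun h => by
        have := hmono (kstar + 1) (kstar + 1 + 1) (by omega) (by omega) (by omega)
        linarith)
    simpa using h
  have hlim : 1 ≤ C (kstar + 1) * klBernoulli p d := by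
    have ht : Filter.Tendsto (fun q => C (kstar + 1) * klBernoulli p q)
        (nhdsWithin d (Set.Iio d)) (nhds (C (kstar + 1) * klBernoulli p d)) :=
      ((kl_cont p d (by linarith) hm1 (by linarith) (by linarith)).tendsto.const_mul
        _).mono_left nhdsWithin_le_nhds
    refine ge_of_tendsto ht ?_
    filter_upwards [Ioo_mem_nhdsLT hmd] with q hq
    exact hc q hq.1 hq.2
  have hterm : C (kstar + 1) * |μ kstar - μ (kstar + 1)|
      ≤ ∑ k ∈ (Finset.Icc 1 K).erase kstar, C k * |μ kstar - μ k| :=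
    Finset.single_le_sum (f := fun k => C k * |μ kstar - μ k|)
      (fun k hk => mul_nonneg (hC0 k (Finset.mem_of_mem_erase hk)) (abs_nonneg _)) hmem
  refine le_trans ?_ hterm
  rw [← hpdef, habs, div_le_iff₀ hI]
  nlinarith [mul_le_mul_of_nonneg_left hlim (by linarith : 0 ≤ p - μ kstar)]
end
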